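/- arXiv:1704.05782 — 15 statements merged into one kernel-verified Lean document; each statement's English description precedes it below -/
import Mathlib

section
/- Let A^(1),…,A^(K) be symmetric real n×n matrices and let p̲ ≤ p̄ in ℝ^K, with midpoint p_c = (p̲+p̄)/2 and radius p_Δ = (p̄−p̲)/2. Then A(p) = Σ_{k=1}^K p_k A^(k) is positive semidefinite for every p in the box [p̲,p̄] if and only if for every x ∈ ℝ^n one has xᵀ A(p_c) x − Σ_{k=1}^K |xᵀ A^(k) x| · (p_Δ)_k ≥ 0. -/
open Matrix

theorem dotProduct_sum_smul_mulVec {m ι R : Type*} [Fintype m] [Fintype ι] [CommSemiring R]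
    (A : ι → Matrix m m R) (p : ι → R) (x : m → R) :
    x ⬝ᵥ ((∑ k, p k • A k) *ᵥ x) = ∑ k, p k * (x ⬝ᵥ (A k *ᵥ x)) := by
  simp only [sum_mulVec, dotProduct_sum, smul_mulVec, dotProduct_smul, smul_eq_mul]

theorem midpoint_mul_sub_abs_mul_radius_le {l u p q : ℝ} (hl : l ≤ p) (hu : p ≤ u) :
    (l + u) / 2 * q - |q| * ((u - l) / 2) ≤ p * q := by
  rcases abs_cases q with ⟨h, hq⟩ | ⟨h, hq⟩ <;> rw [h] <;> nlinarith

theorem strong_psd_iff_quadratic_form {n K : ℕ}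
    (A : Fin K → Matrix (Fin n) (Fin n) ℝ) (hA : ∀ k, (A k).IsSymm)
    (pl pu : Fin K → ℝ) (hp : pl ≤ pu) :
    (∀ p : Fin K → ℝ, pl ≤ p → p ≤ pu → (∑ k, p k • A k).PosSemidef) ↔
    (∀ x : Fin n → ℝ,
      x ⬝ᵥ ((∑ k, ((pl k + pu k) / 2) • A k) *ᵥ x) -
        ∑ k, |x ⬝ᵥ (A k *ᵥ x)| * ((pu k - pl k) / 2) ≥ 0) := by
  simp only [dotProduct_sum_smul_mulVec A (fun k => (pl k + pu k) / 2), ← Finset.sum_sub_distrib]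
  constructor
  · intro h x
    -- The minimum over the box is attained at the vertex chosen by the signs of `xᵀ A k x`.
    let v : Fin K → ℝ := fun k => if 0 ≤ x ⬝ᵥ (A k *ᵥ x) then pl k else pu k
    have hv := (h v (fun k => by dsimp only [v]; split_ifs; exacts [le_rfl, hp k])
      (fun k => by dsimp only [v]; split_ifs; exacts [hp k, le_rfl])).dotProduct_mulVec_nonneg x
    rw [star_trivial, dotProduct_sum_smul_mulVec] at hv
    refine hv.trans_eq (Finset.sum_congr rfl fun k _ => ?_)
    dsimp only [v]
    split_ifs with hk
    · rw [abs_of_nonneg hk]; ring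
    · rw [abs_of_neg (not_le.mp hk)]; ring
  · intro h p hl hu
    refine .of_dotProduct_mulVec_nonneg ?_ fun x => ?_
    · rw [isHermitian_iff_isSymm, IsSymm, transpose_sum]
      exact Finset.sum_congr rfl fun k _ => (hA k).smul (p k)
    · rw [star_trivial, dotProduct_sum_smul_mulVec]
      exact (h x).le.trans
        (Finset.sum_le_sum fun k _ => midpoint_mul_sub_abs_mul_radius_le (hl k) (hu k))
end

section
/- Let A^(1),…,A^(K) be symmetric real n×n matrices, let p̲ ≤ p̄ in ℝ^K, and suppose A^(i) is positive semidefinite for some index i. Then A(p) = Σ_{k=1}^K p_k A^(k) is positive semidefinite for every p in the box [p̲,p̄] if and only if A(p) is positive semidefinite for every p ∈ [p̲,p̄] with p_i = p̲_i. -/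
theorem strong_psd_fix_lower {n K : ℕ}
    (A : Fin K → Matrix (Fin n) (Fin n) ℝ) (hA : ∀ k, (A k).IsSymm)
    (pl pu : Fin K → ℝ) (hp : pl ≤ pu)
    (i : Fin K) (hi : (A i).PosSemidef) :
    (∀ p : Fin K → ℝ, pl ≤ p → p ≤ pu → (∑ k, p k • A k).PosSemidef) ↔
    (∀ p : Fin K → ℝ, pl ≤ p → p ≤ pu → p i = pl i →
      (∑ k, p k • A k).PosSemidef) := by
  refine ⟨fun h p h₁ h₂ _ => h p h₁ h₂, fun h p h₁ h₂ => ?_⟩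
  have hq := h (Function.update p i (pl i)) (le_update_iff.2 ⟨le_rfl, fun j _ => h₁ j⟩)
    (update_le_iff.2 ⟨hp i, fun j _ => h₂ j⟩) (Function.update_self ..)
  have hsum : ∑ k, p k • A k =
      ∑ k, Function.update p i (pl i) k • A k + (p i - pl i) • A i := by
    rw [← Finset.add_sum_erase _ _ (Finset.mem_univ i),
      ← Finset.add_sum_erase _ (fun k => Function.update p i (pl i) k • A k)
        (Finset.mem_univ i),
      Finset.sum_congr rfl fun k hk => by
        rw [← Function.update_of_ne (Finset.ne_of_mem_erase hk) (pl i) p]]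
    simp only [Function.update_self, sub_smul]
    abel
  rw [hsum]
  exact hq.add (hi.smul (sub_nonneg.2 (h₁ i)))
end

section
/- Let A^(1),…,A^(K) be symmetric real n×n matrices, let p̲ ≤ p̄ in ℝ^K, and suppose −A^(i) is positive semidefinite (i.e., A^(i) is negative semidefinite) for some index i. Then A(p) = Σ_{k=1}^K p_k A^(k) is positive semidefinite for every p in the box [p̲,p̄] if and only if A(p) is positive semidefinite for every p ∈ [p̲,p̄] with p_i = p̄_i. -/
theorem strong_psd_fix_upper {n K : ℕ}
    (A : Fin K → Matrix (Fin n) (Fin n) ℝ) (hA : ∀ k, (A k).IsSymm)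
    (pl pu : Fin K → ℝ) (hp : pl ≤ pu)
    (i : Fin K) (hi : (-(A i)).PosSemidef) :
    (∀ p : Fin K → ℝ, pl ≤ p → p ≤ pu → (∑ k, p k • A k).PosSemidef) ↔
    (∀ p : Fin K → ℝ, pl ≤ p → p ≤ pu → p i = pu i →
      (∑ k, p k • A k).PosSemidef) := by
  refine ⟨fun h p hl hu _ => h p hl hu, fun h p hl hu => ?_⟩
  have hq : (∑ k, Function.update p i (pu i) k • A k).PosSemidef :=
    h _ (le_update_iff.2 ⟨hp i, fun j _ => hl j⟩) (update_le_iff.2 ⟨le_rfl, fun j _ => hu j⟩)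
      (Function.update_self ..)
  have key : ∑ k, p k • A k =
      ∑ k, Function.update p i (pu i) k • A k + (pu i - p i) • -(A i) := by
    rw [← Finset.add_sum_erase _ _ (Finset.mem_univ i),
      ← Finset.add_sum_erase _ (fun k => Function.update p i (pu i) k • A k) (Finset.mem_univ i),
      Finset.sum_congr rfl fun k hk => by
        rw [← Function.update_of_ne (Finset.ne_of_mem_erase hk) (pu i) p],
      Function.update_self]
    module
  rw [key]
  exact hq.add (hi.smul (sub_nonneg.2 (hu i)))
end

section
/- Let A^(1),…,A^(K) be symmetric real n×n matrices, let p̲ ≤ p̄ in ℝ^K, and suppose that for each k = 1,…,K we are given positive semidefinite matrices A^(k)_1, A^(k)_2 with A^(k) = A^(k)_1 − A^(k)_2. If the matrix Σ_{k=1}^K ( p̲_k · A^(k)_1 − p̄_k · A^(k)_2 ) is positive semidefinite, then A(p) = Σ_{k=1}^K p_k A^(k) is positive semidefinite for every p in the box [p̲,p̄]. -/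
theorem strong_psd_sufficient_splitting {n K : ℕ}
    (A A1 A2 : Fin K → Matrix (Fin n) (Fin n) ℝ) (hA : ∀ k, (A k).IsSymm)
    (pl pu : Fin K → ℝ) (hp : pl ≤ pu)
    (h1 : ∀ k, (A1 k).PosSemidef) (h2 : ∀ k, (A2 k).PosSemidef)
    (hsplit : ∀ k, A k = A1 k - A2 k)
    (hmat : (∑ k, (pl k • A1 k - pu k • A2 k)).PosSemidef) :
    ∀ p : Fin K → ℝ, pl ≤ p → p ≤ pu → (∑ k, p k • A k).PosSemidef := by
  intro p hl hu
  have hdecomp : ∑ k, p k • A k = ∑ k, (pl k • A1 k - pu k • A2 k) +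
      ∑ k, ((p k - pl k) • A1 k + (pu k - p k) • A2 k) := by
    rw [← Finset.sum_add_distrib]
    refine Finset.sum_congr rfl fun k _ => ?_
    rw [hsplit k]
    module
  rw [hdecomp]
  exact hmat.add <| Matrix.posSemidef_sum _ fun k _ =>
    ((h1 k).smul (sub_nonneg.2 (hl k))).add ((h2 k).smul (sub_nonneg.2 (hu k)))
end

section
/- Let A^(1),…,A^(K) be symmetric real n×n matrices, let p̲ ≤ p̄ in ℝ^K, and suppose that for each k = 1,…,K we are given positive semidefinite matrices A^(k)_1, A^(k)_2 with A^(k) = A^(k)_1 − A^(k)_2. If there exists p in the box [p̲,p̄] such that A(p) = Σ_{k=1}^K p_k A^(k) is positive semidefinite, then the matrix Σ_{k=1}^K ( p̄_k · A^(k)_1 − p̲_k · A^(k)_2 ) is positive semidefinite. -/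
theorem weak_psd_necessary_splitting {n K : ℕ}
    (A A1 A2 : Fin K → Matrix (Fin n) (Fin n) ℝ) (hA : ∀ k, (A k).IsSymm)
    (pl pu : Fin K → ℝ) (hp : pl ≤ pu)
    (h1 : ∀ k, (A1 k).PosSemidef) (h2 : ∀ k, (A2 k).PosSemidef)
    (hsplit : ∀ k, A k = A1 k - A2 k)
    (hweak : ∃ p : Fin K → ℝ, pl ≤ p ∧ p ≤ pu ∧ (∑ k, p k • A k).PosSemidef) :
    (∑ k, (pu k • A1 k - pl k • A2 k)).PosSemidef := by
  obtain ⟨p, hlp, hpu, hpsd⟩ := hweak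
  have key : ∑ k, (pu k • A1 k - pl k • A2 k) =
      ∑ k, p k • A k + ∑ k, ((pu k - p k) • A1 k + (p k - pl k) • A2 k) := by
    rw [← Finset.sum_add_distrib]
    refine Finset.sum_congr rfl fun k _ => ?_
    rw [hsplit k]
    module
  rw [key]
  exact hpsd.add <| Matrix.posSemidef_sum _ fun k _ =>
    ((h1 k).smul (sub_nonneg.2 (hpu k))).add ((h2 k).smul (sub_nonneg.2 (hlp k)))
end

section
/- Let A^(1),…,A^(K) be symmetric real n×n matrices, let p̲ ≤ p̄ in ℝ^K, and suppose A^(i) is positive semidefinite for some index i. Then A(p) = Σ_{k=1}^K p_k A^(k) is positive definite for every p in the box [p̲,p̄] if and only if A(p) is positive definite for every p ∈ [p̲,p̄] with p_i = p̲_i. -/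
theorem strong_pd_fix_lower {n K : ℕ}
    (A : Fin K → Matrix (Fin n) (Fin n) ℝ) (hA : ∀ k, (A k).IsSymm)
    (pl pu : Fin K → ℝ) (hp : pl ≤ pu)
    (i : Fin K) (hi : (A i).PosSemidef) :
    (∀ p : Fin K → ℝ, pl ≤ p → p ≤ pu → (∑ k, p k • A k).PosDef) ↔
    (∀ p : Fin K → ℝ, pl ≤ p → p ≤ pu → p i = pl i →
      (∑ k, p k • A k).PosDef) := by
  refine ⟨fun h p h₁ h₂ _ => h p h₁ h₂, fun h p h₁ h₂ => ?_⟩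
  have hq : (∑ k, Function.update p i (pl i) k • A k).PosDef := by
    refine h _ ?_ ?_ (Function.update_self ..)
    · exact le_update_iff.2 ⟨le_rfl, fun j _ => h₁ j⟩
    · exact update_le_iff.2 ⟨hp i, fun j _ => h₂ j⟩
  have hsum : ∑ k, p k • A k =
      ∑ k, Function.update p i (pl i) k • A k + (p i - pl i) • A i := by
    rw [← Finset.add_sum_erase _ _ (Finset.mem_univ i),
      ← Finset.add_sum_erase _ (fun k => Function.update p i (pl i) k • A k)
        (Finset.mem_univ i),
      Finset.sum_congr rfl fun k hk => by
        rw [← Function.update_of_ne (Finset.ne_of_mem_erase hk) (pl i) p]]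
    simp only [Function.update_self]
    module
  rw [hsum]
  exact hq.add_posSemidef (hi.smul (sub_nonneg.2 (h₁ i)))
end

section
/- Let A^(1),…,A^(K) be symmetric real n×n matrices, let p̲ ≤ p̄ in ℝ^K, and suppose −A^(i) is positive semidefinite (i.e., A^(i) is negative semidefinite) for some index i. Then A(p) = Σ_{k=1}^K p_k A^(k) is positive definite for every p in the box [p̲,p̄] if and only if A(p) is positive definite for every p ∈ [p̲,p̄] with p_i = p̄_i. -/
theorem strong_pd_fix_upper {n K : ℕ}
    (A : Fin K → Matrix (Fin n) (Fin n) ℝ) (hA : ∀ k, (A k).IsSymm)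
    (pl pu : Fin K → ℝ) (hp : pl ≤ pu)
    (i : Fin K) (hi : (-(A i)).PosSemidef) :
    (∀ p : Fin K → ℝ, pl ≤ p → p ≤ pu → (∑ k, p k • A k).PosDef) ↔
    (∀ p : Fin K → ℝ, pl ≤ p → p ≤ pu → p i = pu i →
      (∑ k, p k • A k).PosDef) := by
  refine ⟨fun h p hl hu _ => h p hl hu, fun h p hl hu => ?_⟩
  have hq := h (Function.update p i (pu i))
    (le_update_iff.2 ⟨hp i, fun j _ => hl j⟩)
    (update_le_iff.2 ⟨le_rfl, fun j _ => hu j⟩) (Function.update_self ..)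
  have hsum : ∑ k, p k • A k =
      (∑ k, Function.update p i (pu i) k • A k) + (pu i - p i) • -(A i) := by
    have herase : ∑ k ∈ Finset.univ.erase i, Function.update p i (pu i) k • A k =
        ∑ k ∈ Finset.univ.erase i, p k • A k :=
      Finset.sum_congr rfl fun k hk => by
        rw [Function.update_of_ne (Finset.ne_of_mem_erase hk)]
    rw [← Finset.add_sum_erase _ (fun k => p k • A k) (Finset.mem_univ i),
      ← Finset.add_sum_erase _ (fun k => Function.update p i (pu i) k • A k)
        (Finset.mem_univ i), herase, Function.update_self]
    module
  rw [hsum]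
  exact hq.add_posSemidef (hi.smul (sub_nonneg.2 (hu i)))
end

section
/- Let A^(1),…,A^(K) be symmetric real n×n matrices, let p̲ ≤ p̄ in ℝ^K, and suppose that for each k = 1,…,K we are given positive semidefinite matrices A^(k)_1, A^(k)_2 with A^(k) = A^(k)_1 − A^(k)_2. If the matrix Σ_{k=1}^K ( p̲_k · A^(k)_1 − p̄_k · A^(k)_2 ) is positive definite, then A(p) = Σ_{k=1}^K p_k A^(k) is positive definite for every p in the box [p̲,p̄]. -/
theorem strong_pd_sufficient_splitting {n K : ℕ}
    (A A1 A2 : Fin K → Matrix (Fin n) (Fin n) ℝ) (hA : ∀ k, (A k).IsSymm)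
    (pl pu : Fin K → ℝ) (hp : pl ≤ pu)
    (h1 : ∀ k, (A1 k).PosSemidef) (h2 : ∀ k, (A2 k).PosSemidef)
    (hsplit : ∀ k, A k = A1 k - A2 k)
    (hmat : (∑ k, (pl k • A1 k - pu k • A2 k)).PosDef) :
    ∀ p : Fin K → ℝ, pl ≤ p → p ≤ pu → (∑ k, p k • A k).PosDef := by
  intro p hpl hpu
  have hrest : (∑ k, ((p k - pl k) • A1 k + (pu k - p k) • A2 k)).PosSemidef :=
    Matrix.posSemidef_sum _ fun k _ =>
      ((h1 k).smul (sub_nonneg.2 (hpl k))).add ((h2 k).smul (sub_nonneg.2 (hpu k)))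
  have hsum : ∑ k, p k • A k = ∑ k, (pl k • A1 k - pu k • A2 k) +
      ∑ k, ((p k - pl k) • A1 k + (pu k - p k) • A2 k) := by
    rw [← Finset.sum_add_distrib]
    refine Finset.sum_congr rfl fun k _ => ?_
    rw [hsplit k]
    module
  rw [hsum]
  exact hmat.add_posSemidef hrest
end

section
/- Let A^(1),…,A^(K) be symmetric real n×n matrices and let p̲ ≤ p̄ in ℝ^K. Then A(p) = Σ_{k=1}^K p_k A^(k) is positive definite for every p in the box [p̲,p̄] if and only if both of the following hold: (1) there exists p ∈ [p̲,p̄] such that A(p) is positive definite, and (2) A(p) is nonsingular (invertible) for every p ∈ [p̲,p̄]. -/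
open scoped MatrixOrder in
/-- If the segment from a positive definite matrix to a Hermitian matrix consists of invertible
matrices, then its endpoint is positive definite. -/
theorem Matrix.PosDef.of_isUnit_segment {ι : Type*} [Fintype ι] [DecidableEq ι]
    {P B : Matrix ι ι ℝ} (hP : P.PosDef) (hB : B.IsHermitian)
    (h : ∀ t : ℝ, 0 ≤ t → t ≤ 1 → IsUnit ((1 - t) • P + t • B)) : B.PosDef := by
  obtain ⟨C, hC, rfl⟩ : ∃ C : Matrix ι ι ℝ, IsUnit C ∧ P = star C * C :=
    (CStarAlgebra.isStrictlyPositive_iff_eq_star_mul_self).mp hP.isStrictlyPositive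
  obtain ⟨U, hCU, hUC⟩ := isUnit_iff_exists.mp hC
  have hU : IsUnit U := isUnit_iff_exists.mpr ⟨C, hUC, hCU⟩
  have hone : star U * (star C * C) * U = 1 := by
    rw [← mul_assoc, ← star_mul, hCU, star_one, one_mul, hCU]
  rw [← Matrix.IsUnit.posDef_star_left_conjugate_iff hU]
  have hN : (star U * B * U).IsHermitian := Matrix.isHermitian_conjTranspose_mul_mul U hB
  rw [hN.posDef_iff_eigenvalues_pos]
  by_contra! hneg
  obtain ⟨i, hi⟩ := hneg
  have hd : 0 < 1 - hN.eigenvalues i := by linarith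
  have hunit := (hU.star.mul (h (1 - hN.eigenvalues i)⁻¹ (by positivity)
    (inv_le_one_of_one_le₀ (by linarith)))).mul hU
  rw [mul_add, add_mul, mul_smul_comm, smul_mul_assoc, hone, mul_smul_comm,
    smul_mul_assoc] at hunit
  have hv := hN.mulVec_eigenvectorBasis i
  have hzero : ⇑(hN.eigenvectorBasis i) = 0 := by
    apply Matrix.mulVec_injective_of_isUnit hunit
    simp only [Matrix.add_mulVec, Matrix.smul_mulVec, Matrix.one_mulVec, Matrix.mulVec_zero]
    rw [hv, smul_smul, ← add_smul]
    convert zero_smul ℝ _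
    field_simp
    ring
  apply hN.eigenvectorBasis.orthonormal.ne_zero i
  ext j
  exact congrFun hzero j

theorem strong_pd_iff_pd_and_regular {n K : ℕ}
    (A : Fin K → Matrix (Fin n) (Fin n) ℝ) (hA : ∀ k, (A k).IsSymm)
    (pl pu : Fin K → ℝ) (hp : pl ≤ pu) :
    (∀ p : Fin K → ℝ, pl ≤ p → p ≤ pu → (∑ k, p k • A k).PosDef) ↔
    ((∃ p : Fin K → ℝ, pl ≤ p ∧ p ≤ pu ∧ (∑ k, p k • A k).PosDef) ∧
     (∀ p : Fin K → ℝ, pl ≤ p → p ≤ pu → IsUnit (∑ k, p k • A k))) := by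
  refine ⟨fun h => ⟨⟨pl, le_rfl, hp, h pl le_rfl hp⟩, fun p h₁ h₂ => (h p h₁ h₂).isUnit⟩, ?_⟩
  rintro ⟨⟨q, hq₁, hq₂, hq⟩, hreg⟩ p hp₁ hp₂
  refine hq.of_isUnit_segment ?_ fun t ht₀ ht₁ => ?_
  · simp only [Matrix.IsHermitian, Matrix.conjTranspose_eq_transpose_of_trivial,
      Matrix.transpose_sum, Matrix.transpose_smul, (hA _).eq]
  · have hmem : (1 - t) • q + t • p ∈ Set.Icc pl pu :=
      convex_Icc pl pu ⟨hq₁, hq₂⟩ ⟨hp₁, hp₂⟩ (sub_nonneg.mpr ht₁) ht₀ (by ring)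
    simpa [add_smul, Finset.sum_add_distrib, Finset.smul_sum, smul_smul]
      using hreg _ hmem.1 hmem.2
end

section
/- Let A^(1),…,A^(K) be symmetric real n×n matrices, let p̲ ≤ p̄ in ℝ^K, and suppose that for each k = 1,…,K we are given positive semidefinite matrices A^(k)_1, A^(k)_2 with A^(k) = A^(k)_1 − A^(k)_2. If there exists p in the box [p̲,p̄] such that A(p) = Σ_{k=1}^K p_k A^(k) is positive definite, then the matrix Σ_{k=1}^K ( p̄_k · A^(k)_1 − p̲_k · A^(k)_2 ) is positive definite. -/
theorem weak_pd_necessary_splitting {n K : ℕ}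
    (A A1 A2 : Fin K → Matrix (Fin n) (Fin n) ℝ) (hA : ∀ k, (A k).IsSymm)
    (pl pu : Fin K → ℝ) (hp : pl ≤ pu)
    (h1 : ∀ k, (A1 k).PosSemidef) (h2 : ∀ k, (A2 k).PosSemidef)
    (hsplit : ∀ k, A k = A1 k - A2 k)
    (hweak : ∃ p : Fin K → ℝ, pl ≤ p ∧ p ≤ pu ∧ (∑ k, p k • A k).PosDef) :
    (∑ k, (pu k • A1 k - pl k • A2 k)).PosDef := by
  obtain ⟨p, hlp, hpu, hpos⟩ := hweak
  have hdiff : (∑ k, ((pu k - p k) • A1 k + (p k - pl k) • A2 k)).PosSemidef :=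
    Matrix.posSemidef_sum _ fun k _ =>
      ((h1 k).smul (sub_nonneg.2 (hpu k))).add ((h2 k).smul (sub_nonneg.2 (hlp k)))
  have heq : ∑ k, (pu k • A1 k - pl k • A2 k) =
      ∑ k, p k • A k + ∑ k, ((pu k - p k) • A1 k + (p k - pl k) • A2 k) := by
    rw [← Finset.sum_add_distrib]
    refine Finset.sum_congr rfl fun k _ => ?_
    rw [hsplit]
    module
  rw [heq]
  exact hpos.add_posSemidef hdiff
end

section
/- Let A_c and A_Δ be symmetric real n×n matrices with A_Δ entrywise nonnegative. Then every symmetric matrix A satisfying |A − A_c| ≤ A_Δ entrywise is positive semidefinite if and only if for every sign vector z ∈ {−1, 1}^n the matrix A_c − D_z A_Δ D_z is positive semidefinite, where D_z denotes the diagonal matrix with diagonal entries z_1,…,z_n. -/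
theorem interval_psd_iff_signs {n : ℕ}
    (Ac AΔ : Matrix (Fin n) (Fin n) ℝ)
    (hAc : Ac.IsSymm) (hAΔ : AΔ.IsSymm) (hΔ : ∀ i j, 0 ≤ AΔ i j) :
    (∀ A : Matrix (Fin n) (Fin n) ℝ, A.IsSymm →
      (∀ i j, |A i j - Ac i j| ≤ AΔ i j) → A.PosSemidef) ↔
    (∀ z : Fin n → ℝ, (∀ i, z i = 1 ∨ z i = -1) →
      (Ac - Matrix.diagonal z * AΔ * Matrix.diagonal z).PosSemidef) := by
  constructor
  · intro h z hz
    refine h _ ?_ fun i j => ?_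
    · ext i j
      simp only [Matrix.transpose_apply, Matrix.sub_apply, Matrix.mul_diagonal,
        Matrix.diagonal_mul, hAc.apply i j, hAΔ.apply i j]
      ring
    · simp only [Matrix.sub_apply, Matrix.mul_diagonal, Matrix.diagonal_mul, sub_sub_cancel_left,
        abs_neg, abs_mul, abs_of_nonneg (hΔ i j)]
      rcases hz i with hi | hi <;> rcases hz j with hj | hj <;> simp [hi, hj]
  · intro h A hA hAb
    refine Matrix.PosSemidef.of_dotProduct_mulVec_nonneg ?_ fun x => ?_
    · simpa [Matrix.IsHermitian, Matrix.IsSymm, Matrix.conjTranspose_eq_transpose_of_trivial] using hA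
    · let z : Fin n → ℝ := fun i => if 0 ≤ x i then 1 else -1
      have hz : ∀ i, z i = 1 ∨ z i = -1 := fun i => by
        by_cases hi : 0 ≤ x i <;> simp [z, hi]
      have hzx : ∀ i, z i * x i = |x i| := fun i => by
        by_cases hi : 0 ≤ x i
        · simp [z, hi, abs_of_nonneg]
        · simp [z, hi, abs_of_neg (not_le.mp hi)]
      refine ((h z hz).dotProduct_mulVec_nonneg x).trans ?_
      simp only [dotProduct, Matrix.mulVec, Finset.mul_sum]
      refine Finset.sum_le_sum fun i _ => Finset.sum_le_sum fun j _ => ?_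
      simp only [Pi.star_apply, star_trivial, Matrix.sub_apply, Matrix.mul_diagonal,
        Matrix.diagonal_mul]
      have hbound : |(A i j - Ac i j) * (x i * x j)| ≤ AΔ i j * (|x i| * |x j|) := by
        rw [abs_mul, abs_mul]
        exact mul_le_mul_of_nonneg_right (hAb i j) (by positivity)
      rw [← hzx i, ← hzx j] at hbound
      linarith [neg_le_of_abs_le hbound]
end

section
/- Let A_c and A_Δ be symmetric real n×n matrices with A_Δ entrywise nonnegative. Then every symmetric matrix A satisfying |A − A_c| ≤ A_Δ entrywise is positive semidefinite if and only if for every x ∈ ℝ^n one has xᵀ A_c x − |x|ᵀ A_Δ |x| ≥ 0, where |x| denotes the vector of componentwise absolute values of x. -/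
open Matrix

lemma Matrix.dotProduct_mulVec_eq_sum {ι R : Type*} [Fintype ι] [CommSemiring R]
    (A : Matrix ι ι R) (x : ι → R) :
    x ⬝ᵥ (A *ᵥ x) = ∑ i, ∑ j, A i j * (x i * x j) := by
  simp only [dotProduct, mulVec, Finset.mul_sum]
  exact Finset.sum_congr rfl fun i _ => Finset.sum_congr rfl fun j _ => by ring

lemma Matrix.dotProduct_mulVec_sub_abs_eq_sum {ι : Type*} [Fintype ι]
    (A D : Matrix ι ι ℝ) (x : ι → ℝ) :
    x ⬝ᵥ (A *ᵥ x) - (fun i => |x i|) ⬝ᵥ (D *ᵥ fun i => |x i|) =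
      ∑ i, ∑ j, (A i j * (x i * x j) - D i j * (|x i| * |x j|)) := by
  simp only [dotProduct_mulVec_eq_sum, Finset.sum_sub_distrib]

lemma abs_sign_le_one (a : ℝ) : |(SignType.sign a : ℝ)| ≤ 1 := by
  rcases lt_trichotomy a 0 with h | h | h <;> simp [h]

theorem interval_psd_iff_quadratic_form {n : ℕ}
    (Ac AΔ : Matrix (Fin n) (Fin n) ℝ)
    (hAc : Ac.IsSymm) (hAΔ : AΔ.IsSymm) (hΔ : ∀ i j, 0 ≤ AΔ i j) :
    (∀ A : Matrix (Fin n) (Fin n) ℝ, A.IsSymm →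
      (∀ i j, |A i j - Ac i j| ≤ AΔ i j) → A.PosSemidef) ↔
    (∀ x : Fin n → ℝ,
      x ⬝ᵥ (Ac *ᵥ x) - (fun i => |x i|) ⬝ᵥ (AΔ *ᵥ fun i => |x i|) ≥ 0) := by
  constructor
  · intro h x
    let s : Fin n → ℝ := fun i => SignType.sign (x i)
    have hs : ∀ i, s i * x i = |x i| := fun i => sign_mul_self (x i)
    let B : Matrix (Fin n) (Fin n) ℝ := Matrix.of fun i j => Ac i j - s i * s j * AΔ i j
    have hB : B.PosSemidef := by
      refine h B (Matrix.IsSymm.ext fun i j => ?_) fun i j => ?_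
      · simp only [B, of_apply, hAc.apply i j, hAΔ.apply i j, mul_comm (s i)]
      · have hij : |s i| * |s j| ≤ 1 :=
          mul_le_one₀ (abs_sign_le_one _) (abs_nonneg _) (abs_sign_le_one _)
        calc |B i j - Ac i j| = |s i| * |s j| * AΔ i j := by
              simp [B, abs_mul, abs_of_nonneg (hΔ i j)]
          _ ≤ AΔ i j := mul_le_of_le_one_left (hΔ i j) hij
    have hq := hB.dotProduct_mulVec_nonneg x
    rw [star_trivial, dotProduct_mulVec_eq_sum] at hq
    rw [dotProduct_mulVec_sub_abs_eq_sum]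
    refine hq.trans_eq (Finset.sum_congr rfl fun i _ => Finset.sum_congr rfl fun j _ => ?_)
    rw [← hs i, ← hs j]
    simp only [B, of_apply]
    ring
  · intro h A hA hAD
    refine .of_dotProduct_mulVec_nonneg (by simpa [IsHermitian, IsSymm] using hA) fun x => ?_
    have hx := h x
    rw [dotProduct_mulVec_sub_abs_eq_sum] at hx
    rw [star_trivial, dotProduct_mulVec_eq_sum]
    refine le_trans hx (Finset.sum_le_sum fun i _ => Finset.sum_le_sum fun j _ => ?_)
    have hij : |(A i j - Ac i j) * (x i * x j)| ≤ AΔ i j * (|x i| * |x j|) := by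
      rw [abs_mul, abs_mul (x i)]
      gcongr
      exact hAD i j
    linarith [neg_le_of_abs_le hij]
end

section
/- Let A_c and A_Δ be symmetric real n×n matrices with A_Δ entrywise nonnegative. Then every symmetric matrix A satisfying |A − A_c| ≤ A_Δ entrywise is positive definite if and only if for every sign vector z ∈ {−1, 1}^n the matrix A_c − D_z A_Δ D_z is positive definite, where D_z denotes the diagonal matrix with diagonal entries z_1,…,z_n. -/
/-- Positive definiteness passes from the matrix `B` to the symmetric matrix `A` if every term of
the quadratic form of `A` dominates the corresponding term at `B`, where `B` may depend on the
vector. -/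
theorem Matrix.PosDef.of_forall_exists_mul_le {ι : Type*} [Fintype ι] {A : Matrix ι ι ℝ}
    (hA : A.IsSymm)
    (h : ∀ x : ι → ℝ, ∃ B : Matrix ι ι ℝ, B.PosDef ∧
      ∀ i j, x i * (B i j * x j) ≤ x i * (A i j * x j)) : A.PosDef := by
  refine .of_dotProduct_mulVec_pos (by simpa [Matrix.IsHermitian] using hA.eq) fun x hx => ?_
  obtain ⟨B, hB, hle⟩ := h x
  refine (hB.dotProduct_mulVec_pos hx).trans_le ?_
  simp only [dotProduct, Matrix.mulVec, Finset.mul_sum, star_trivial]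
  exact Finset.sum_le_sum fun i _ => Finset.sum_le_sum fun j _ => hle i j

theorem interval_pd_iff_signs {n : ℕ}
    (Ac AΔ : Matrix (Fin n) (Fin n) ℝ)
    (hAc : Ac.IsSymm) (hAΔ : AΔ.IsSymm) (hΔ : ∀ i j, 0 ≤ AΔ i j) :
    (∀ A : Matrix (Fin n) (Fin n) ℝ, A.IsSymm →
      (∀ i j, |A i j - Ac i j| ≤ AΔ i j) → A.PosDef) ↔
    (∀ z : Fin n → ℝ, (∀ i, z i = 1 ∨ z i = -1) →
      (Ac - Matrix.diagonal z * AΔ * Matrix.diagonal z).PosDef) := by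
  constructor
  · intro h z hz
    refine h _ (hAc.sub ?_) fun i j => ?_
    · simp [Matrix.IsSymm, Matrix.transpose_mul, hAΔ.eq, Matrix.mul_assoc]
    · have habs (k : Fin n) : |z k| = 1 := by rcases hz k with h | h <;> simp [h]
      simp [abs_mul, habs, abs_of_nonneg (hΔ i j)]
  · intro h A hA hle
    refine .of_forall_exists_mul_le hA fun x => ?_
    let z : Fin n → ℝ := fun i => if 0 ≤ x i then 1 else -1
    have hz (i : Fin n) : z i = 1 ∨ z i = -1 := by
      by_cases hi : 0 ≤ x i <;> simp [z, hi]
    have hzx (i : Fin n) : z i * x i = |x i| := by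
      by_cases hi : 0 ≤ x i
      · simp [z, hi, abs_of_nonneg hi]
      · simp [z, hi, abs_of_neg (not_le.mp hi)]
    refine ⟨_, h z hz, fun i j => ?_⟩
    have hbound : -((A i j - Ac i j) * (x i * x j)) ≤ AΔ i j * (|x i| * |x j|) := by
      refine (neg_le_abs _).trans ?_
      rw [abs_mul, abs_mul]
      exact mul_le_mul_of_nonneg_right (hle i j) (by positivity)
    rw [← hzx i, ← hzx j] at hbound
    simp only [Matrix.sub_apply, Matrix.mul_diagonal, Matrix.diagonal_mul]
    linarith
end

section
/- Let A_c and A_Δ be symmetric real n×n matrices with A_Δ entrywise nonnegative. Then every symmetric matrix A satisfying |A − A_c| ≤ A_Δ entrywise is positive definite if and only if both of the following hold: (1) the matrix A_c is positive definite, and (2) every (not necessarily symmetric) real n×n matrix B with |B − A_c| ≤ A_Δ entrywise is nonsingular (invertible). -/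
open scoped MatrixOrder in
open Matrix in
/-- If every convex combination of a positive definite `M` and a symmetric `N` is nonsingular,
then `N` is positive definite. -/
theorem posDef_of_isUnit_segment {ι : Type*} [Fintype ι] [DecidableEq ι] {M N : Matrix ι ι ℝ}
    (hM : M.PosDef) (hN : N.IsHermitian)
    (h : ∀ t : ℝ, 0 ≤ t → t ≤ 1 → IsUnit ((1 - t) • M + t • N)) : N.PosDef := by
  obtain ⟨C, hC, rfl⟩ : ∃ C : Matrix ι ι ℝ, IsUnit C ∧ M = Cᴴ * C :=
    CStarAlgebra.isStrictlyPositive_iff_eq_star_mul_self.1 hM.isStrictlyPositive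
  have hCd := (Matrix.isUnit_iff_isUnit_det C).1 hC
  have hCinv : C * C⁻¹ = 1 := mul_nonsing_inv C hCd
  have hCinv' : Cᴴ * (C⁻¹)ᴴ = 1 := by
    rw [← conjTranspose_mul, nonsing_inv_mul C hCd, conjTranspose_one]
  set P := (C⁻¹)ᴴ * N * C⁻¹ with hP
  have hPH : P.IsHermitian := isHermitian_conjTranspose_mul_mul _ hN
  refine (Matrix.IsUnit.posDef_star_left_conjugate_iff
    ((Matrix.isUnit_nonsing_inv_iff).2 hC)).1 ?_
  change P.PosDef
  refine hPH.posDef_iff_eigenvalues_pos.2 fun i ↦ ?_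
  by_contra! hl
  set l := hPH.eigenvalues i
  set v : ι → ℝ := ⇑(hPH.eigenvectorBasis i) with hv
  have hPv : P *ᵥ v = l • v := hPH.mulVec_eigenvectorBasis i
  have hv0 : v ≠ 0 := by
    intro h0
    exact hPH.eigenvectorBasis.orthonormal.ne_zero i (by ext j; exact congrFun h0 j)
  have hw : C *ᵥ (C⁻¹ *ᵥ v) = v := by rw [mulVec_mulVec, hCinv, one_mulVec]
  have hNw : N *ᵥ (C⁻¹ *ᵥ v) = l • (Cᴴ *ᵥ v) := by
    rw [← mulVec_smul, ← hPv, mulVec_mulVec, mulVec_mulVec, hP, ← mul_assoc, ← mul_assoc,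
      hCinv', one_mul]
  have hpos : 0 < 1 - l := by linarith
  have hU := h (1 / (1 - l)) (by positivity) (by rw [div_le_one hpos]; linarith)
  have hzero : ((1 - 1 / (1 - l)) • (Cᴴ * C) + (1 / (1 - l)) • N) *ᵥ (C⁻¹ *ᵥ v) = 0 := by
    rw [add_mulVec, smul_mulVec, smul_mulVec, hNw, ← mulVec_mulVec, hw, smul_smul, ← add_smul]
    have : 1 - 1 / (1 - l) + 1 / (1 - l) * l = 0 := by field_simp; ring
    rw [this, zero_smul]
  have hw0 := mulVec_injective_of_isUnit hU (hzero.trans (mulVec_zero _).symm)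
  exact hv0 (by rw [← hw, hw0, mulVec_zero])

theorem interval_pd_iff_midpoint_pd_and_regular {n : ℕ}
    (Ac AΔ : Matrix (Fin n) (Fin n) ℝ)
    (hAc : Ac.IsSymm) (hAΔ : AΔ.IsSymm) (hΔ : ∀ i j, 0 ≤ AΔ i j) :
    (∀ A : Matrix (Fin n) (Fin n) ℝ, A.IsSymm →
      (∀ i j, |A i j - Ac i j| ≤ AΔ i j) → A.PosDef) ↔
    (Ac.PosDef ∧
      ∀ B : Matrix (Fin n) (Fin n) ℝ,
        (∀ i j, |B i j - Ac i j| ≤ AΔ i j) → IsUnit B) := by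
  constructor
  · intro h
    refine ⟨h Ac hAc (by simpa using hΔ), fun B hB ↦ ?_⟩
    have hS : ((1 / 2 : ℝ) • (B + B.transpose)).PosDef := by
      refine h _ ?_ fun i j ↦ ?_
      · rw [Matrix.IsSymm, Matrix.transpose_smul, Matrix.transpose_add,
          Matrix.transpose_transpose, add_comm]
      · have h1 := abs_le.1 (hB i j)
        have h2 := abs_le.1 (hB j i)
        rw [hAc.apply i j, hAΔ.apply i j] at h2
        simp only [Matrix.smul_apply, Matrix.add_apply, Matrix.transpose_apply, smul_eq_mul]
        exact abs_le.2 ⟨by linarith [h1.1, h2.1], by linarith [h1.2, h2.2]⟩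
    rw [Matrix.isUnit_iff_isUnit_det, isUnit_iff_ne_zero]
    intro hdet
    obtain ⟨x, hx0, hx⟩ := Matrix.exists_mulVec_eq_zero_iff.2 hdet
    have hpos := hS.dotProduct_mulVec_pos hx0
    rw [star_trivial, Matrix.smul_mulVec, Matrix.add_mulVec, hx, zero_add, dotProduct_smul,
      Matrix.mulVec_transpose, dotProduct_comm, ← Matrix.dotProduct_mulVec, hx] at hpos
    simp at hpos
  · rintro ⟨hpd, hreg⟩ A hA hAB
    refine posDef_of_isUnit_segment hpd ((Matrix.conjTranspose_eq_transpose_of_trivial A).trans hA)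
      fun t ht0 ht1 ↦ hreg _ fun i j ↦ ?_
    have : ((1 - t) • Ac + t • A) i j - Ac i j = t * (A i j - Ac i j) := by
      simp only [Matrix.add_apply, Matrix.smul_apply, smul_eq_mul]; ring
    rw [this, abs_mul, abs_of_nonneg ht0]
    exact (mul_le_of_le_one_left (abs_nonneg _) ht1).trans (hAB i j)
end

section
/- Let A^(1),…,A^(K) be symmetric real n×n matrices and let p̲ ≤ p̄ in ℝ^K. Suppose that for every k = 1,…,K, the matrix A^(k) is either positive semidefinite or negative semidefinite. Define q ∈ ℝ^K by q_k = p̲_k if A^(k) is positive semidefinite and q_k = p̄_k otherwise. Then A(p) = Σ_{k=1}^K p_k A^(k) is positive semidefinite for every p in the box [p̲,p̄] if and only if A(q) is positive semidefinite. -/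
theorem strong_psd_iff_single_vertex {n K : ℕ}
    (A : Fin K → Matrix (Fin n) (Fin n) ℝ) (hA : ∀ k, (A k).IsSymm)
    (pl pu : Fin K → ℝ) (hp : pl ≤ pu)
    (hsd : ∀ k, (A k).PosSemidef ∨ (-(A k)).PosSemidef)
    (q : Fin K → ℝ)
    (hq : ∀ k, ((A k).PosSemidef ∧ q k = pl k) ∨
               (¬ (A k).PosSemidef ∧ q k = pu k)) :
    (∀ p : Fin K → ℝ, pl ≤ p → p ≤ pu → (∑ k, p k • A k).PosSemidef) ↔
    (∑ k, q k • A k).PosSemidef := by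
  constructor
  · intro h
    refine h q (fun k => ?_) (fun k => ?_)
    · rcases hq k with ⟨-, hk⟩ | ⟨-, hk⟩ <;> rw [hk]
      exact hp k
    · rcases hq k with ⟨-, hk⟩ | ⟨-, hk⟩ <;> rw [hk]
      exact hp k
  · intro h p hpl hpu
    have hdiff : (∑ k, (p k - q k) • A k).PosSemidef := by
      refine Matrix.posSemidef_sum _ fun k _ => ?_
      rcases hq k with ⟨hk, hqk⟩ | ⟨hk, hqk⟩
      · exact hk.smul (sub_nonneg.2 (hqk.trans_le (hpl k)))
      · rw [← neg_smul_neg]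
        refine ((hsd k).resolve_left hk).smul ?_
        rw [neg_sub, hqk]
        exact sub_nonneg.2 (hpu k)
    have hsum : ∑ k, p k • A k = ∑ k, q k • A k + ∑ k, (p k - q k) • A k := by
      rw [← Finset.sum_add_distrib]
      exact Finset.sum_congr rfl fun k _ => by rw [← add_smul, add_sub_cancel]
    exact hsum ▸ h.add hdiff
end
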